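/- Let t ≤ n and G ≥ γ(t). Then for all ε ∈ [0,1], Σ_{E ∈ F_QM(G)∖F_ML} ε^{|E|}(1−ε)^{n−|E|} ≤ 2ⁿ · ε^{t+1}; equivalently, p_L^QM(G)(ε) − p_L^ML(ε) ≤ 2ⁿ · ε^{t+1}. -/

import Mathlib

/-- Support of a vector over 𝔽₂, as a finset of coordinates. -/
def supp {n : ℕ} (v : Fin n → ZMod 2) : Finset (Fin n) :=
  Finset.univ.filter (fun j => v j ≠ 0)

/-- `S` is a stopping set of `H`: `S` is nonempty and every check with at least one
neighbor in `S` has at least two neighbors in `S`. -/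
def IsStoppingSet {m n : ℕ} (H : Matrix (Fin m) (Fin n) (ZMod 2)) (S : Finset (Fin n)) : Prop :=
  S.Nonempty ∧ ∀ i : Fin m,
    1 ≤ (S.filter (fun j => H i j = 1)).card → 2 ≤ (S.filter (fun j => H i j = 1)).card

/-- Check `i` is dangling for the erasure set `E`: exactly one `j ∈ E` has `H i j = 1`. -/
def Dangling {m n : ℕ} (H : Matrix (Fin m) (Fin n) (ZMod 2)) (E : Finset (Fin n))
    (i : Fin m) : Prop :=
  (E.filter (fun j => H i j = 1)).card = 1

/-- A peel step: some check `i` is dangling for `E` with unique erased neighbor `j`,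
which is removed from `E`. -/
def PeelStep {m n : ℕ} (H : Matrix (Fin m) (Fin n) (ZMod 2)) (E E' : Finset (Fin n)) : Prop :=
  ∃ i : Fin m, ∃ j ∈ E, E.filter (fun j' => H i j' = 1) = {j} ∧ E' = E.erase j

/-- A guess step: permitted only when no check is dangling for `E`; removes an
arbitrary single element of `E`. -/
def GuessStep {m n : ℕ} (H : Matrix (Fin m) (Fin n) (ZMod 2)) (E E' : Finset (Fin n)) : Prop :=
  (∀ i : Fin m, ¬ Dangling H E i) ∧ ∃ j ∈ E, E' = E.erase j

/-- A Maxwell step is a peel step or a guess step. -/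
def MaxwellStep {m n : ℕ} (H : Matrix (Fin m) (Fin n) (ZMod 2)) (E E' : Finset (Fin n)) : Prop :=
  PeelStep H E E' ∨ GuessStep H E E'

/-- A Maxwell trace from `E`: a finite sequence of peel/guess steps transforming `E`
into the empty set. -/
def IsMaxwellTrace {m n : ℕ} (H : Matrix (Fin m) (Fin n) (ZMod 2)) (E : Finset (Fin n))
    (k : ℕ) (f : Fin (k+1) → Finset (Fin n)) : Prop :=
  f 0 = E ∧ f (Fin.last k) = ∅ ∧ ∀ i : Fin k, MaxwellStep H (f i.castSucc) (f i.succ)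

/-- Number of guess steps in a trace: the steps starting from a state with no
dangling check (these are exactly the guess steps). -/
noncomputable def guessCount {m n : ℕ} (H : Matrix (Fin m) (Fin n) (ZMod 2)) {k : ℕ}
    (f : Fin (k+1) → Finset (Fin n)) : ℕ :=
  Nat.card {i : Fin k // ∀ c : Fin m, ¬ Dangling H (f i.castSucc) c}

/-- Row space of `H`: the 𝔽₂-span of the rows of `H` in 𝔽₂ⁿ. -/
def rowSpace {m n : ℕ} (H : Matrix (Fin m) (Fin n) (ZMod 2)) :
    Submodule (ZMod 2) (Fin n → ZMod 2) :=
  Submodule.span (ZMod 2) (Set.range fun i => H i)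

/-- Nontrivial logical operator of the CSS code `(HX, HZ)`. -/
def IsNTLO {mX mZ n : ℕ} (HX : Matrix (Fin mX) (Fin n) (ZMod 2))
    (HZ : Matrix (Fin mZ) (Fin n) (ZMod 2)) (v : Fin n → ZMod 2) : Prop :=
  v ≠ 0 ∧ ((HZ.mulVec v = 0 ∧ v ∉ rowSpace HX) ∨ (HX.mulVec v = 0 ∧ v ∉ rowSpace HZ))

/-- A stopping set of the CSS code: a stopping set of `HX` or of `HZ`. -/
def IsCSSStoppingSet {mX mZ n : ℕ} (HX : Matrix (Fin mX) (Fin n) (ZMod 2))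
    (HZ : Matrix (Fin mZ) (Fin n) (ZMod 2)) (S : Finset (Fin n)) : Prop :=
  IsStoppingSet HX S ∨ IsStoppingSet HZ S

/-- `ASS w`: number of `w`-element subsets of coordinates that are stopping sets
of the CSS code. -/
noncomputable def ASS {mX mZ n : ℕ} (HX : Matrix (Fin mX) (Fin n) (ZMod 2))
    (HZ : Matrix (Fin mZ) (Fin n) (ZMod 2)) (w : ℕ) : ℕ :=
  Nat.card {S : Finset (Fin n) // S.card = w ∧ IsCSSStoppingSet HX HZ S}

/-- `ANTLO w`: number of `w`-element subsets of coordinates that are the support of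
some nontrivial logical operator. -/
noncomputable def ANTLO {mX mZ n : ℕ} (HX : Matrix (Fin mX) (Fin n) (ZMod 2))
    (HZ : Matrix (Fin mZ) (Fin n) (ZMod 2)) (w : ℕ) : ℕ :=
  Nat.card {S : Finset (Fin n) // S.card = w ∧ ∃ v, IsNTLO HX HZ v ∧ supp v = S}

/-- `W0 t = {w : 0 < w ≤ t and ASS w > ANTLO w}`. -/
noncomputable def W0 {mX mZ n : ℕ} (HX : Matrix (Fin mX) (Fin n) (ZMod 2))
    (HZ : Matrix (Fin mZ) (Fin n) (ZMod 2)) (t : ℕ) : Finset ℕ :=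
  (Finset.range (t+1)).filter (fun w => 0 < w ∧ ANTLO HX HZ w < ASS HX HZ w)

/-- The distribution gap `γ(t) = |W0(t)|`. -/
noncomputable def gam {mX mZ n : ℕ} (HX : Matrix (Fin mX) (Fin n) (ZMod 2))
    (HZ : Matrix (Fin mZ) (Fin n) (ZMod 2)) (t : ℕ) : ℕ :=
  (W0 HX HZ t).card

/-- `F_ML`: erasure sets containing the support of some NTLO. -/
def FML {mX mZ n : ℕ} (HX : Matrix (Fin mX) (Fin n) (ZMod 2))
    (HZ : Matrix (Fin mZ) (Fin n) (ZMod 2)) : Set (Finset (Fin n)) :=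
  {E | ∃ v, IsNTLO HX HZ v ∧ supp v ⊆ E}

/-- `F_QM(G)`: erasure sets admitting some Maxwell trace (with respect to `HZ` or to
`HX`) with more than `G` guess steps. -/
def FQM {mX mZ n : ℕ} (HX : Matrix (Fin mX) (Fin n) (ZMod 2))
    (HZ : Matrix (Fin mZ) (Fin n) (ZMod 2)) (G : ℕ) : Set (Finset (Fin n)) :=
  {E | (∃ (k : ℕ) (f : Fin (k+1) → Finset (Fin n)),
          IsMaxwellTrace HZ E k f ∧ G < guessCount HZ f) ∨
       (∃ (k : ℕ) (f : Fin (k+1) → Finset (Fin n)),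
          IsMaxwellTrace HX E k f ∧ G < guessCount HX f)}

open Classical in
/-- `P_F(ε) = Σ_{E ∈ F} ε^{|E|} (1-ε)^{n-|E|}`. -/
noncomputable def Pfail (n : ℕ) (F : Set (Finset (Fin n))) (ε : ℝ) : ℝ :=
  ∑ E ∈ Finset.univ.filter (fun E : Finset (Fin n) => E ∈ F),
    ε ^ E.card * (1 - ε) ^ (n - E.card)

/-- The support of a nonzero vector in the kernel of `H` is a stopping set of `H`. -/
theorem isStoppingSet_supp {m n : ℕ} {H : Matrix (Fin m) (Fin n) (ZMod 2)}
    {v : Fin n → ZMod 2} (hv : v ≠ 0) (h : H.mulVec v = 0) : IsStoppingSet H (supp v) := by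
  have two (x : ZMod 2) : x = 0 ∨ x = 1 := by revert x; decide
  refine ⟨?_, fun i hi => ?_⟩
  · obtain ⟨j, hj⟩ := Function.ne_iff.1 hv
    exact ⟨j, by simpa [supp] using hj⟩
  · by_contra hlt
    have hcard : ((supp v).filter (fun j => H i j = 1)).card = 1 := by omega
    have hsum : (((supp v).filter (fun j => H i j = 1)).card : ZMod 2) = 0 := by
      have hi0 : ∑ j, H i j * v j = 0 := congrFun h i
      rw [Finset.card_filter, supp, Nat.cast_sum, Finset.sum_filter]
      refine (Finset.sum_congr rfl fun j _ => ?_).trans hi0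
      rcases two (v j) with h1 | h1 <;> rcases two (H i j) with h2 | h2 <;> simp [h1, h2]
    rw [hcard] at hsum
    exact absurd hsum (by decide)

theorem IsNTLO.isCSSStoppingSet_supp {mX mZ n : ℕ} {HX : Matrix (Fin mX) (Fin n) (ZMod 2)}
    {HZ : Matrix (Fin mZ) (Fin n) (ZMod 2)} {v : Fin n → ZMod 2} (hv : IsNTLO HX HZ v) :
    IsCSSStoppingSet HX HZ (supp v) := by
  obtain ⟨hne, ⟨h, -⟩ | ⟨h, -⟩⟩ := hv
  · exact Or.inr (isStoppingSet_supp hne h)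
  · exact Or.inl (isStoppingSet_supp hne h)

theorem MaxwellStep.exists_erase {m n : ℕ} {H : Matrix (Fin m) (Fin n) (ZMod 2)}
    {E E' : Finset (Fin n)} (h : MaxwellStep H E E') : ∃ j ∈ E, E' = E.erase j := by
  rcases h with ⟨-, j, hj, -, h⟩ | ⟨-, j, hj, h⟩ <;> exact ⟨j, hj, h⟩

theorem isStoppingSet_of_forall_not_dangling {m n : ℕ} {H : Matrix (Fin m) (Fin n) (ZMod 2)}
    {E : Finset (Fin n)} (hne : E.Nonempty) (h : ∀ i, ¬ Dangling H E i) : IsStoppingSet H E := by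
  refine ⟨hne, fun i hi => ?_⟩
  have := h i
  unfold Dangling at this
  omega

theorem IsMaxwellTrace.subset_and_card_add {m n : ℕ} {H : Matrix (Fin m) (Fin n) (ZMod 2)}
    {E : Finset (Fin n)} {k : ℕ} {f : Fin (k + 1) → Finset (Fin n)} (hf : IsMaxwellTrace H E k f)
    (i : Fin (k + 1)) : f i ⊆ E ∧ (f i).card + i = E.card := by
  induction i using Fin.induction with
  | zero => simp [hf.1]
  | succ i ih =>
    obtain ⟨j, hj, he⟩ := (hf.2.2 i).exists_erase
    have hc := Finset.card_erase_add_one hj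
    rw [he]
    refine ⟨(Finset.erase_subset _ _).trans ih.1, ?_⟩
    have := ih.2
    simp only [Fin.val_castSucc, Fin.val_succ] at this ⊢
    omega

/-- A stopping set that is not the support of an NTLO makes the weight enumerators differ. -/
theorem mem_W0 {mX mZ n : ℕ} {HX : Matrix (Fin mX) (Fin n) (ZMod 2)}
    {HZ : Matrix (Fin mZ) (Fin n) (ZMod 2)} {t : ℕ} {S : Finset (Fin n)} (hne : S.Nonempty)
    (hS : IsCSSStoppingSet HX HZ S) (hcard : S.card ≤ t) (hML : S ∉ FML HX HZ) :
    S.card ∈ W0 HX HZ t := by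
  refine Finset.mem_filter.2 ⟨by simpa [Nat.lt_succ_iff] using hcard, hne.card_pos, ?_⟩
  refine Set.ncard_lt_ncard (t := {T | T.card = S.card ∧ IsCSSStoppingSet HX HZ T})
    (s := {T | T.card = S.card ∧ ∃ v, IsNTLO HX HZ v ∧ supp v = T})
    ⟨?_, fun h => ?_⟩ (Set.toFinite _)
  · rintro T ⟨hT, v, hv, rfl⟩
    exact ⟨hT, hv.isCSSStoppingSet_supp⟩
  · obtain ⟨-, v, hv, hvS⟩ := h ⟨rfl, hS⟩
    exact hML ⟨v, hv, hvS.subset⟩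

/-- Below the weight `t`, an erasure set free of NTLO supports needs at most `γ(t)` guesses. -/
theorem IsMaxwellTrace.guessCount_le_gam {m mX mZ n : ℕ} {H : Matrix (Fin m) (Fin n) (ZMod 2)}
    {HX : Matrix (Fin mX) (Fin n) (ZMod 2)} {HZ : Matrix (Fin mZ) (Fin n) (ZMod 2)}
    (hH : ∀ S, IsStoppingSet H S → IsCSSStoppingSet HX HZ S)
    {E : Finset (Fin n)} {k : ℕ} {f : Fin (k + 1) → Finset (Fin n)} (hf : IsMaxwellTrace H E k f)
    {t : ℕ} (hcard : E.card ≤ t) (hML : E ∉ FML HX HZ) :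
    guessCount H f ≤ gam HX HZ t := by
  have key (i : {i : Fin k // ∀ c : Fin m, ¬ Dangling H (f i.castSucc) c}) :
      (f i.1.castSucc).card ∈ W0 HX HZ t := by
    obtain ⟨i, hi⟩ := i
    obtain ⟨j, hj, -⟩ := (hf.2.2 i).exists_erase
    have hsub := (hf.subset_and_card_add i.castSucc).1
    refine mem_W0 ⟨j, hj⟩ (hH _ (isStoppingSet_of_forall_not_dangling ⟨j, hj⟩ hi))
      ((Finset.card_le_card hsub).trans hcard) ?_
    rintro ⟨v, hv, hvS⟩
    exact hML ⟨v, hv, hvS.trans hsub⟩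
  have hinj : Function.Injective fun i => (⟨_, key i⟩ : W0 HX HZ t) := by
    intro a b hab
    have ha := (hf.subset_and_card_add a.1.castSucc).2
    have hb := (hf.subset_and_card_add b.1.castSucc).2
    have hab' : (f a.1.castSucc).card = (f b.1.castSucc).card := congrArg Subtype.val hab
    simp only [Fin.val_castSucc] at ha hb
    exact Subtype.ext (Fin.ext (by omega))
  calc guessCount H f ≤ Nat.card (W0 HX HZ t) := Nat.card_le_card_of_injective _ hinj
    _ = gam HX HZ t := by simp [gam]

theorem lt_card_of_mem_FQM_diff_FML {mX mZ n : ℕ} {HX : Matrix (Fin mX) (Fin n) (ZMod 2)}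
    {HZ : Matrix (Fin mZ) (Fin n) (ZMod 2)} {t G : ℕ} (hG : gam HX HZ t ≤ G)
    {E : Finset (Fin n)} (hE : E ∈ FQM HX HZ G \ FML HX HZ) : t < E.card := by
  by_contra! hcard
  obtain ⟨⟨k, f, hf, hlt⟩ | ⟨k, f, hf, hlt⟩, hML⟩ := hE
  · have := hf.guessCount_le_gam (fun _ h => Or.inr h) hcard hML
    omega
  · have := hf.guessCount_le_gam (fun _ h => Or.inl h) hcard hML
    omega

theorem Pfail_union_sub (n : ℕ) (A B : Set (Finset (Fin n))) (ε : ℝ) :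
    Pfail n (A ∪ B) ε - Pfail n A ε = Pfail n (B \ A) ε := by
  classical
  rw [sub_eq_iff_eq_add, Pfail, Pfail, Pfail, ← Finset.sum_union]
  · refine Finset.sum_congr (Finset.ext fun E => ?_) fun _ _ => rfl
    simp only [Finset.mem_filter, Finset.mem_univ, true_and, Finset.mem_union, Set.mem_union,
      Set.mem_sdiff]
    tauto
  · refine Finset.disjoint_left.2 fun E hB hA => ?_
    simp only [Finset.mem_filter, Finset.mem_univ, true_and, Set.mem_sdiff] at hA hB
    exact hB.2 hA

theorem Pfail_le_of_forall_le_card {n w : ℕ} {F : Set (Finset (Fin n))}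
    (hF : ∀ E ∈ F, w ≤ E.card) {ε : ℝ} (hε : ε ∈ Set.Icc (0 : ℝ) 1) :
    Pfail n F ε ≤ 2 ^ n * ε ^ w := by
  classical
  have h0 : 0 ≤ 1 - ε := sub_nonneg.2 hε.2
  have hcard : (Finset.univ.filter (fun E : Finset (Fin n) => E ∈ F)).card ≤ 2 ^ n := by
    simpa using Finset.card_filter_le (Finset.univ : Finset (Finset (Fin n))) (· ∈ F)
  calc Pfail n F ε
      ≤ (Finset.univ.filter (fun E : Finset (Fin n) => E ∈ F)).card • ε ^ w := by
        refine Finset.sum_le_card_nsmul _ _ _ fun E hE => ?_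
        calc ε ^ E.card * (1 - ε) ^ (n - E.card) ≤ ε ^ E.card * 1 := by
              refine mul_le_mul_of_nonneg_left (pow_le_one₀ h0 ?_) (pow_nonneg hε.1 _)
              linarith [hε.1]
          _ ≤ ε ^ w := by
              rw [mul_one]
              exact pow_le_pow_of_le_one hε.1 hε.2 (hF E (Finset.mem_filter.1 hE).2)
    _ ≤ 2 ^ n * ε ^ w := by
        rw [nsmul_eq_mul]
        exact mul_le_mul_of_nonneg_right (by exact_mod_cast hcard) (pow_nonneg hε.1 _)

/-- For `t ≤ n` and `G ≥ γ(t)`, for all `ε ∈ [0,1]`,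
`Σ_{E ∈ F_QM(G) \ F_ML} ε^{|E|}(1-ε)^{n-|E|} ≤ 2^n ε^{t+1}`; equivalently
`p_L^QM(G)(ε) - p_L^ML(ε) ≤ 2^n ε^{t+1}`. -/
theorem gap_polynomial_bound {mX mZ n : ℕ}
    (HX : Matrix (Fin mX) (Fin n) (ZMod 2)) (HZ : Matrix (Fin mZ) (Fin n) (ZMod 2))
    (hCSS : HX * HZ.transpose = 0) (t G : ℕ) (ht : t ≤ n)
    (hG : gam HX HZ t ≤ G) :
    ∀ ε : ℝ, ε ∈ Set.Icc (0 : ℝ) 1 →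
      Pfail n (FQM HX HZ G \ FML HX HZ) ε ≤ 2 ^ n * ε ^ (t + 1) ∧
      Pfail n (FML HX HZ ∪ FQM HX HZ G) ε - Pfail n (FML HX HZ) ε ≤
        2 ^ n * ε ^ (t + 1) := by
  intro ε hε
  have h : Pfail n (FQM HX HZ G \ FML HX HZ) ε ≤ 2 ^ n * ε ^ (t + 1) :=
    Pfail_le_of_forall_le_card (fun _ hE => lt_card_of_mem_FQM_diff_FML hG hE) hε
  exact ⟨h, (Pfail_union_sub n _ _ ε).trans_le h⟩
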